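/- Let ℙ be a finitely characterized, stationary, ergodic process over a finite alphabet 𝒳 with positive-probability predictive equivalence classes E_1,…,E_N, and let T = Σ_{x∈𝒳} T^(x) be the transition matrix of its history ε-machine. Then the directed graph of the history ε-machine (edge i→j whenever T_{ij} > 0) consists entirely of disjoint strongly connected components: whenever (T^n)_{ij} > 0 for some n ≥ 1, there exists m ≥ 1 with (T^m)_{ji} > 0. -/

import Mathlib

open MeasureTheory Filter Topology
open scoped Classical

namespace EM

variable {X : Type*} [Fintype X] [MeasurableSpace X] [MeasurableSingletonClass X]

/-- The left shift on bi-infinite sequences. -/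
def shift (ω : ℤ → X) : ℤ → X := fun n => ω (n + 1)

/-- ℙ(w): probability of the cylinder set of the word `w` at position 0. -/
noncomputable def wordProb (μ : Measure (ℤ → X)) (w : List X) : ℝ :=
  (μ {ω | ∀ k : Fin w.length, ω ((k : ℕ) : ℤ) = w.get k}).toReal

/-- Stationarity: invariance of the measure under the shift. -/
def Stationary (μ : Measure (ℤ → X)) : Prop := Measure.map shift μ = μ

/-- Ergodicity: every shift-invariant measurable event is trivial. -/
def Ergodic' (μ : Measure (ℤ → X)) : Prop :=
  ∀ A : Set (ℤ → X), MeasurableSet A → shift ⁻¹' A = A → μ A = 0 ∨ μ A = 1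

/-- Projection of a bi-infinite sequence to its past:  (pastMap ω) n = x_{-(n+1)}. -/
def pastMap (ω : ℤ → X) : ℕ → X := fun n => ω (-((n : ℤ) + 1))

/-- ℙ⁻ : the marginal of ℙ on past sequences. -/
noncomputable def pastMeasure (μ : Measure (ℤ → X)) : Measure (ℕ → X) :=
  Measure.map pastMap μ

/-- x⃖^t = x_{-t} … x_{-1}, the last `t` symbols of the past `p`, as a word. -/
def pastWord (p : ℕ → X) (t : ℕ) : List X := (List.range t).reverse.map p

/-- A past is nontrivial if all of its finite suffixes have positive probability. -/
def Nontrivial' (μ : Measure (ℤ → X)) (p : ℕ → X) : Prop :=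
  ∀ t : ℕ, 0 < wordProb μ (pastWord p t)

/-- ℙ(w | v) = ℙ(vw)/ℙ(v): conditional probability that `w` follows `v`. -/
noncomputable def condProb (μ : Measure (ℤ → X)) (w v : List X) : ℝ :=
  wordProb μ (v ++ w) / wordProb μ v

/-- A past is `w`-regular if it is nontrivial and lim_{t→∞} ℙ(w|x⃖^t) exists. -/
def WRegular (μ : Measure (ℤ → X)) (p : ℕ → X) (w : List X) : Prop :=
  Nontrivial' μ p ∧ ∃ L : ℝ, Tendsto (fun t => condProb μ w (pastWord p t)) atTop (𝓝 L)

/-- A past is regular if it is nontrivial and `w`-regular for every nonempty word `w`. -/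
def Regular (μ : Measure (ℤ → X)) (p : ℕ → X) : Prop :=
  Nontrivial' μ p ∧ ∀ w : List X, w ≠ [] →
    ∃ L : ℝ, Tendsto (fun t => condProb μ w (pastWord p t)) atTop (𝓝 L)

/-- 𝐏(w|x⃖) = lim_{t→∞} ℙ(w|x⃖^t)  (meaningful for regular pasts). -/
noncomputable def predProb (μ : Measure (ℤ → X)) (p : ℕ → X) (w : List X) : ℝ :=
  limUnder atTop (fun t => condProb μ w (pastWord p t))

/-- The past x⃖x obtained by appending the symbol `x` to the past x⃖. -/
def extendPast (p : ℕ → X) (x : X) : ℕ → X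
  | 0 => x
  | n + 1 => p n

/-- The past obtained by appending a word symbol by symbol. -/
def extendWord (p : ℕ → X) : List X → (ℕ → X)
  | [] => p
  | x :: u => extendWord (extendPast p x) u

/-- The predictive equivalence class of the (regular) past `p`. -/
def classOf (μ : Measure (ℤ → X)) (p : ℕ → X) : Set (ℕ → X) :=
  {q | Regular μ q ∧ ∀ w : List X, w ≠ [] → predProb μ q w = predProb μ p w}

section HMM

variable {S : Type*} [Fintype S] [DecidableEq S]

/-- T^(w) = T^(w₀) ⋯ T^(w_{l-1}). -/
def wordMatrix (T : X → Matrix S S ℝ) (w : List X) : Matrix S S ℝ :=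
  (w.map T).prod

/-- 𝐏_{σ_i}(w) = ‖e_i T^(w)‖₁, the probability of emitting `w` from state `i`. -/
noncomputable def stateWordProb (T : X → Matrix S S ℝ) (i : S) (w : List X) : ℝ :=
  ∑ j, wordMatrix T w i j

/-- All transition matrices have nonnegative entries. -/
def HMMNonneg (T : X → Matrix S S ℝ) : Prop := ∀ x i j, 0 ≤ T x i j

/-- The overall transition matrix T = Σ_x T^(x) is row-stochastic. -/
def HMMStochastic (T : X → Matrix S S ℝ) : Prop := ∀ i, ∑ x : X, ∑ j, T x i j = 1

/-- The overall state-to-state transition matrix T = Σ_x T^(x). -/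
noncomputable def totalT (T : X → Matrix S S ℝ) : Matrix S S ℝ := ∑ x : X, T x

/-- Irreducibility: the directed graph with an edge i → j whenever T_{ij} > 0 is
strongly connected. -/
def Irreducible' (T : X → Matrix S S ℝ) : Prop :=
  ∀ i j : S, ∃ n : ℕ, 0 < n ∧ 0 < (totalT T ^ n) i j

/-- Unifilarity: from each state, each symbol leads to at most one state. -/
def Unifilar (T : X → Matrix S S ℝ) : Prop :=
  ∀ (x : X) (i j k : S), 0 < T x i j → 0 < T x i k → j = k

/-- Probabilistically distinct states. -/
def ProbDistinct (T : X → Matrix S S ℝ) : Prop :=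
  ∀ i j : S, i ≠ j → ∃ w : List X, w ≠ [] ∧ stateWordProb T i w ≠ stateWordProb T j w

/-- π is a stationary distribution for the HMM: π ≥ 0, Σπ = 1, π = πT. -/
def IsStationaryDist (T : X → Matrix S S ℝ) (π : S → ℝ) : Prop :=
  (∀ i, 0 ≤ π i) ∧ (∑ i, π i = 1) ∧ (∀ j, ∑ i, π i * totalT T i j = π j)

/-- A generator ε-machine: a valid, irreducible, unifilar HMM with
probabilistically distinct states. -/
def IsGenEM (T : X → Matrix S S ℝ) : Prop :=
  HMMNonneg T ∧ HMMStochastic T ∧ Irreducible' T ∧ Unifilar T ∧ ProbDistinct T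

/-- The set of regular pasts whose predictions agree with state `i` of the HMM `T`. -/
def stateClass (μ : Measure (ℤ → X)) (T : X → Matrix S S ℝ) (i : S) : Set (ℕ → X) :=
  {q | Regular μ q ∧ ∀ w : List X, w ≠ [] → predProb μ q w = stateWordProb T i w}

end HMM

/-- The symbol-labeled transition matrices of the history ε-machine, given
representatives `p i` of the positive-probability predictive equivalence classes:
T^(x)_{ij} = 𝐏(x|E_i) if 𝐏(x|E_i) > 0 and δ_h(E_i,x) = E_j, and 0 otherwise. -/
noncomputable def histT (μ : Measure (ℤ → X)) {N : ℕ} (p : Fin N → (ℕ → X)) (x : X) :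
    Matrix (Fin N) (Fin N) ℝ := fun i j =>
  if 0 < predProb μ (p i) [x] ∧ classOf μ (extendPast (p i) x) = classOf μ (p j)
  then predProb μ (p i) [x] else 0

/-- ℙ is finitely characterized, with the pasts `p i` representing the finitely many
positive-probability predictive equivalence classes E_i = classOf μ (p i). -/
def FinitelyCharacterized (μ : Measure (ℤ → X)) {N : ℕ} (p : Fin N → (ℕ → X)) : Prop :=
  (∀ i, Regular μ (p i)) ∧
  (∀ i j : Fin N, i ≠ j → classOf μ (p i) ≠ classOf μ (p j)) ∧
  (∀ i, 0 < pastMeasure μ (classOf μ (p i))) ∧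
  (∑ i, pastMeasure μ (classOf μ (p i)) = 1)

end EM

namespace EM

section Cylinders

variable {X : Type*}

/-- The event that the word `w` occurs at position `n`. -/
def cylinderAt (n : ℤ) (w : List X) : Set (ℤ → X) :=
  {ω | ∀ (k : ℕ) (h : k < w.length), ω (n + k) = w[k]}

lemma cylinderAt_append (n : ℤ) (v w : List X) :
    cylinderAt n (v ++ w) = cylinderAt n v ∩ cylinderAt (n + v.length) w := by
  ext ω
  simp only [cylinderAt, Set.mem_inter_iff, Set.mem_ofPred_eq]
  constructor
  · intro h
    refine ⟨fun k hk => ?_, fun k hk => ?_⟩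
    · rw [h k (by simp; omega), List.getElem_append_left hk]
    · have := h (v.length + k) (by simp; omega)
      rw [List.getElem_append_right (by omega)] at this
      simpa [add_assoc] using this
  · rintro ⟨h₁, h₂⟩ k hk
    by_cases hkv : k < v.length
    · rw [h₁ k hkv, List.getElem_append_left hkv]
    · rw [List.getElem_append_right (by omega), ← h₂ (k - v.length) (by simp at hk; omega)]
      congr 1
      omega

lemma length_pastWord (q : ℕ → X) (t : ℕ) : (pastWord q t).length = t := by
  simp [pastWord]

lemma pastWord_congr {q q' : ℕ → X} {t : ℕ} (h : ∀ k < t, q k = q' k) :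
    pastWord q t = pastWord q' t := by
  unfold pastWord
  refine List.map_congr_left fun k hk => h k ?_
  simpa using hk

lemma pastWord_extendPast (q : ℕ → X) (x : X) (t : ℕ) :
    pastWord (extendPast q x) (t + 1) = pastWord q t ++ [x] := by
  unfold pastWord
  rw [List.range_succ_eq_map]
  simp [extendPast, Function.comp_def]

lemma pastMap_shift (ω : ℤ → X) : pastMap (shift ω) = extendPast (pastMap ω) (ω 0) := by
  funext n
  cases n with
  | zero => simp [pastMap, shift, extendPast]
  | succ n =>
    simp only [pastMap, shift, extendPast]
    congr 1

lemma cylinderAt_pastWord (q : ℕ → X) (t : ℕ) :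
    cylinderAt (-(t : ℤ)) (pastWord q t) = {ω | ∀ k < t, pastMap ω k = q k} := by
  ext ω
  simp only [cylinderAt, Set.mem_ofPred_eq, length_pastWord, pastMap]
  constructor
  · intro h k hk
    have := h (t - 1 - k) (by omega)
    simp only [pastWord, List.getElem_map, List.getElem_reverse, List.getElem_range,
      List.length_range] at this
    rw [show t - 1 - (t - 1 - k) = k by omega] at this
    rw [← this]
    congr 1
    omega
  · intro h k hk
    simp only [pastWord, List.getElem_map, List.getElem_reverse, List.getElem_range,
      List.length_range]
    rw [← h (t - 1 - k) (by omega)]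
    congr 1
    omega

/-- The `t` most recent symbols of a past. -/
def recent (t : ℕ) (q : ℕ → X) : Fin t → X := fun k => q k

lemma recent_eq_iff {t : ℕ} {q q' : ℕ → X} : recent t q = recent t q' ↔ ∀ k < t, q k = q' k := by
  simp only [recent, funext_iff]
  exact ⟨fun h k hk => h ⟨k, hk⟩, fun h k => h k k.2⟩

end Cylinders

section Measurability

variable {X : Type*} [MeasurableSpace X]

lemma measurable_shift : Measurable (shift : (ℤ → X) → ℤ → X) :=
  measurable_pi_lambda _ fun _ => measurable_pi_apply _

lemma measurable_pastMap : Measurable (pastMap : (ℤ → X) → ℕ → X) :=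
  measurable_pi_lambda _ fun _ => measurable_pi_apply _

lemma measurable_recent (t : ℕ) : Measurable (recent t : (ℕ → X) → Fin t → X) :=
  measurable_pi_lambda _ fun _ => measurable_pi_apply _

variable [MeasurableSingletonClass X]

lemma measurableSet_cylinderAt (n : ℤ) (w : List X) : MeasurableSet (cylinderAt n w) := by
  simp only [cylinderAt, Set.ofPred_forall]
  exact .iInter fun k => .iInter fun h =>
    measurable_pi_apply (n + (k : ℤ)) (measurableSet_singleton _)

lemma measurable_comp_pastWord [Fintype X] (f : List X → ℝ) (t : ℕ) :
    Measurable fun q : ℕ → X => f (pastWord q t) := by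
  let g : (Fin t → X) → ℝ := fun a =>
    f ((List.range t).reverse.pmap (fun k (hk : k < t) => a ⟨k, hk⟩) (by simp))
  have hg : Measurable g := measurable_of_finite g
  have : (fun q : ℕ → X => f (pastWord q t)) = g ∘ recent t := by
    funext q
    simp [g, recent, pastWord, List.pmap_eq_map]
  rw [this]
  exact hg.comp (measurable_recent t)

lemma measure_cylinderAt {μ : Measure (ℤ → X)} (hstat : Stationary μ) (n : ℤ) (w : List X) :
    μ (cylinderAt n w) = μ (cylinderAt 0 w) := by
  have step : ∀ n : ℤ, μ (cylinderAt (n + 1) w) = μ (cylinderAt n w) := by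
    intro n
    conv_rhs => rw [← hstat, Measure.map_apply measurable_shift (measurableSet_cylinderAt n w)]
    congr 1
    ext ω
    simp [cylinderAt, shift, add_right_comm]
  induction n with
  | zero => rfl
  | succ n ih => rw [step, ih]
  | pred n ih => rw [← step, sub_add_cancel, ih]

lemma wordProb_eq {μ : Measure (ℤ → X)} (hstat : Stationary μ) (n : ℤ) (w : List X) :
    wordProb μ w = μ.real (cylinderAt n w) := by
  rw [Measure.real, measure_cylinderAt hstat, wordProb]
  congr 2
  ext ω
  simp only [cylinderAt, Set.mem_ofPred_eq, zero_add, List.get_eq_getElem]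
  exact ⟨fun h k hk => h ⟨k, hk⟩, fun h k => h k k.2⟩

end Measurability

section Prediction

variable {X : Type*} [MeasurableSpace X] {μ : Measure (ℤ → X)}

lemma condProb_nonneg (w v : List X) : 0 ≤ condProb μ w v :=
  div_nonneg ENNReal.toReal_nonneg ENNReal.toReal_nonneg

lemma Regular.tendsto {q : ℕ → X} (hq : Regular μ q) {w : List X} (hw : w ≠ []) :
    Tendsto (fun t => condProb μ w (pastWord q t)) atTop (𝓝 (predProb μ q w)) :=
  tendsto_nhds_limUnder (hq.2 w hw)

lemma mem_classOf_iff {q q' : ℕ → X} :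
    q ∈ classOf μ q' ↔ Nontrivial' μ q ∧ ∀ w : List X, w ≠ [] →
      Tendsto (fun t => condProb μ w (pastWord q t)) atTop (𝓝 (predProb μ q' w)) := by
  constructor
  · rintro ⟨hq, h⟩
    exact ⟨hq.1, fun w hw => h w hw ▸ hq.tendsto hw⟩
  · rintro ⟨hq, h⟩
    exact ⟨⟨hq, fun w hw => ⟨_, h w hw⟩⟩, fun w hw => (h w hw).limUnder_eq⟩

lemma classOf_eq_of_mem {q a b : ℕ → X} (ha : q ∈ classOf μ a) (hb : q ∈ classOf μ b) :
    classOf μ a = classOf μ b := by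
  ext r
  refine and_congr_right fun _ => forall₂_congr fun w hw => ?_
  rw [← ha.2 w hw, ← hb.2 w hw]

variable [MeasurableSingletonClass X]

lemma measurableSet_classOf [Fintype X] (q' : ℕ → X) : MeasurableSet (classOf μ q') := by
  have : classOf μ q' = (⋂ t : ℕ, {q | 0 < wordProb μ (pastWord q t)}) ∩
      ⋂ (w : List X), ⋂ (_ : w ≠ []),
        {q | Tendsto (fun t => condProb μ w (pastWord q t)) atTop (𝓝 (predProb μ q' w))} := by
    ext q
    simp [mem_classOf_iff, Nontrivial']
  rw [this]
  refine .inter (.iInter fun t => ?_) (.iInter fun w => .iInter fun _ => ?_)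
  · exact measurableSet_lt measurable_const (measurable_comp_pastWord _ t)
  · exact measurableSet_tendsto _ fun t => measurable_comp_pastWord (condProb μ w) t

variable [IsProbabilityMeasure μ]

lemma wordProb_append_le (hstat : Stationary μ) (v w : List X) :
    wordProb μ (v ++ w) ≤ wordProb μ v := by
  rw [wordProb_eq hstat 0, wordProb_eq hstat 0 v, cylinderAt_append]
  exact measureReal_mono Set.inter_subset_left

lemma condProb_le_one (hstat : Stationary μ) (w v : List X) : condProb μ w v ≤ 1 :=
  div_le_one_of_le₀ (wordProb_append_le hstat v w) ENNReal.toReal_nonneg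

lemma wordProb_pastWord_antitone (hstat : Stationary μ) (q : ℕ → X) :
    Antitone fun t => wordProb μ (pastWord q t) := by
  intro s t hst
  simp only [wordProb_eq hstat (-(s : ℤ)) (pastWord q s),
    wordProb_eq hstat (-(t : ℤ)) (pastWord q t), cylinderAt_pastWord]
  exact measureReal_mono fun ω h k hk => h k (hk.trans_le hst)

/-- Appending a symbol of positive predicted probability is compatible with predictive
equivalence. -/
lemma extendPast_mem_classOf (hstat : Stationary μ) {q q' : ℕ → X} (hq' : Regular μ q')
    (hq : q ∈ classOf μ q') {x : X} (hx : 0 < predProb μ q' [x]) :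
    extendPast q x ∈ classOf μ (extendPast q' x) := by
  have key : ∀ r ∈ classOf μ q', Nontrivial' μ (extendPast r x) ∧ ∀ w : List X, w ≠ [] →
      Tendsto (fun t => condProb μ w (pastWord (extendPast r x) t)) atTop
        (𝓝 (predProb μ q' (x :: w) / predProb μ q' [x])) := by
    intro r hr
    rw [mem_classOf_iff] at hr
    obtain ⟨hr0, hr⟩ := hr
    refine ⟨fun t => ?_, fun w _ => ?_⟩
    · obtain ⟨s, hs, hts⟩ :=
        (((hr [x] (by simp)).eventually_const_lt hx).and (eventually_ge_atTop t)).exists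
      refine lt_of_lt_of_le ?_ (wordProb_pastWord_antitone hstat _ (hts.trans s.le_succ))
      simp only [Nat.succ_eq_add_one, pastWord_extendPast]
      exact (div_pos_iff_of_pos_right (hr0 s)).1 hs
    · rw [← tendsto_add_atTop_iff_nat 1]
      refine ((hr (x :: w) (by simp)).div (hr [x] (by simp)) hx.ne').congr fun t => ?_
      simp only [Pi.div_apply, condProb, pastWord_extendPast, List.append_assoc,
        List.singleton_append]
      rw [div_div_div_cancel_right₀ (hr0 t).ne']
  have hq'' := key q' ⟨hq', fun _ _ => rfl⟩
  rw [mem_classOf_iff]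
  refine ⟨(key q hq).1, fun w hw => ?_⟩
  have h2 : predProb μ (extendPast q' x) w = _ := (hq''.2 w hw).limUnder_eq
  rw [h2]
  exact (key q hq).2 w hw

end Prediction

section NextSymbol

variable {X : Type*} [MeasurableSpace X] {μ : Measure (ℤ → X)}

/-- The law of the past restricted to the event that the next symbol is `x`. -/
noncomputable def pastMeasureNext (μ : Measure (ℤ → X)) (x : X) : Measure (ℕ → X) :=
  (μ.restrict {ω | ω 0 = x}).map pastMap

lemma pastMeasureNext_apply (x : X) {A : Set (ℕ → X)} (hA : MeasurableSet A) :
    pastMeasureNext μ x A = μ {ω | pastMap ω ∈ A ∧ ω 0 = x} := by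
  rw [pastMeasureNext, Measure.map_apply measurable_pastMap hA,
    Measure.restrict_apply (measurable_pastMap hA)]
  rfl

variable [IsProbabilityMeasure μ]

instance : IsProbabilityMeasure (pastMeasure μ) :=
  Measure.isProbabilityMeasure_map measurable_pastMap.aemeasurable

instance (x : X) : IsFiniteMeasure (pastMeasureNext μ x) := by
  unfold pastMeasureNext
  infer_instance

variable [Fintype X] [MeasurableSingletonClass X]

lemma setLIntegral_condProb_recent (hstat : Stationary μ) (x : X) (t : ℕ) (S : Set (Fin t → X)) :
    ∫⁻ q in recent t ⁻¹' S, ENNReal.ofReal (condProb μ [x] (pastWord q t)) ∂pastMeasure μ =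
      pastMeasureNext μ x (recent t ⁻¹' S) := by
  have hS : MeasurableSet S := S.toFinite.measurableSet
  suffices h : ((pastMeasure μ).withDensity
      fun q => ENNReal.ofReal (condProb μ [x] (pastWord q t))).map (recent t) =
      (pastMeasureNext μ x).map (recent t) by
    rw [← withDensity_apply _ (measurable_recent t hS), ← Measure.map_apply (measurable_recent t) hS,
      h, Measure.map_apply (measurable_recent t) hS]
  refine Measure.ext_of_singleton fun a => ?_
  have ha : MeasurableSet (recent t ⁻¹' {a}) := measurable_recent t (measurableSet_singleton a)
  rw [Measure.map_apply (measurable_recent t) (measurableSet_singleton a),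
    Measure.map_apply (measurable_recent t) (measurableSet_singleton a), withDensity_apply _ ha]
  obtain h | ⟨q₀, rfl⟩ := (recent t ⁻¹' {a}).eq_empty_or_nonempty
  · simp [h]
  have hcyl : pastMap ⁻¹' (recent t ⁻¹' {recent t q₀}) =
      cylinderAt (-(t : ℤ)) (pastWord q₀ t) := by
    rw [cylinderAt_pastWord]
    ext ω
    simp [recent_eq_iff]
  have hnext : {ω : ℤ → X | pastMap ω ∈ recent t ⁻¹' {recent t q₀} ∧ ω 0 = x} =
      cylinderAt (-(t : ℤ)) (pastWord q₀ t ++ [x]) := by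
    rw [cylinderAt_append, ← hcyl, length_pastWord]
    ext ω
    simp [cylinderAt]
  rw [setLIntegral_congr_fun (g := fun _ => ENNReal.ofReal (condProb μ [x] (pastWord q₀ t))) ha
      fun q hq => by
        simp only [pastWord_congr (recent_eq_iff.1 hq)],
    setLIntegral_const, pastMeasureNext_apply x ha, pastMeasure,
    Measure.map_apply measurable_pastMap ha, hcyl, hnext, ← ofReal_measureReal,
    ← ofReal_measureReal, ← wordProb_eq hstat, ← wordProb_eq hstat,
    ← ENNReal.ofReal_mul (condProb_nonneg _ _)]
  congr 1
  by_cases h0 : wordProb μ (pastWord q₀ t) = 0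
  · rw [h0, mul_zero]
    exact le_antisymm ENNReal.toReal_nonneg (h0 ▸ wordProb_append_le hstat _ _)
  · exact div_mul_cancel₀ _ h0

/-- If almost every past is regular, `predProb μ · [x]` is the conditional probability of
the next symbol being `x` given the past. -/
lemma pastMeasureNext_eq_withDensity (hstat : Stationary μ)
    (hreg : ∀ᵐ q ∂pastMeasure μ, Regular μ q) (x : X) :
    pastMeasureNext μ x =
      (pastMeasure μ).withDensity fun q => ENNReal.ofReal (predProb μ q [x]) := by
  have key : ∀ (s : ℕ) (S : Set (Fin s → X)), pastMeasureNext μ x (recent s ⁻¹' S) =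
      ((pastMeasure μ).withDensity fun q => ENNReal.ofReal (predProb μ q [x]))
        (recent s ⁻¹' S) := by
    intro s S
    have hS : MeasurableSet (recent s ⁻¹' S) := measurable_recent s S.toFinite.measurableSet
    rw [withDensity_apply _ hS]
    have hlim := tendsto_lintegral_of_dominated_convergence
      (μ := (pastMeasure μ).restrict (recent s ⁻¹' S))
      (F := fun t q => ENNReal.ofReal (condProb μ [x] (pastWord q t)))
      (f := fun q => ENNReal.ofReal (predProb μ q [x])) (fun _ => 1)
      (fun t => (measurable_comp_pastWord (condProb μ [x]) t).ennreal_ofReal)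
      (fun t => .of_forall fun q => ENNReal.ofReal_le_one.2 (condProb_le_one hstat _ _))
      (by simp)
      ((ae_restrict_of_ae hreg).mono fun q hq =>
        ENNReal.tendsto_ofReal (hq.tendsto (by simp)))
    refine tendsto_nhds_unique (tendsto_const_nhds.congr' ?_) hlim
    filter_upwards [eventually_ge_atTop s] with t hst
    have : recent s ⁻¹' S =
        recent t ⁻¹' {a : Fin t → X | (fun k : Fin s => a (k.castLE hst)) ∈ S} := rfl
    rw [this, setLIntegral_condProb_recent hstat]
  refine ext_of_generate_finite _ (generateFrom_measurableCylinders (α := fun _ : ℕ => X)).symm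
    (isPiSystem_measurableCylinders) ?_ (key 0 Set.univ)
  intro A hA
  obtain ⟨I, S, -, rfl⟩ := (mem_measurableCylinders _).1 hA
  have hI : ∀ k ∈ I, k < I.sup id + 1 := fun k hk => Nat.lt_succ_of_le (Finset.le_sup (f := id) hk)
  exact key (I.sup id + 1) {a | (fun k : I => a ⟨k, hI k k.2⟩) ∈ S}

lemma pastMeasureNext_classOf (hstat : Stationary μ)
    (hreg : ∀ᵐ q ∂pastMeasure μ, Regular μ q) (q' : ℕ → X) (x : X) :
    pastMeasureNext μ x (classOf μ q') =
      ENNReal.ofReal (predProb μ q' [x]) * pastMeasure μ (classOf μ q') := by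
  rw [pastMeasureNext_eq_withDensity hstat hreg, withDensity_apply _ (measurableSet_classOf q'),
    setLIntegral_congr_fun (g := fun _ => ENNReal.ofReal (predProb μ q' [x]))
      (measurableSet_classOf q') fun q hq => by simp only [hq.2 [x] (by simp)],
    setLIntegral_const]

end NextSymbol

section HistoryMachine

variable {X : Type*} [MeasurableSpace X] {μ : Measure (ℤ → X)} {N : ℕ} {p : Fin N → (ℕ → X)}

lemma histT_nonneg (x : X) (a b : Fin N) : 0 ≤ histT μ p x a b := by
  unfold histT
  split_ifs with h
  · exact h.1.le
  · exact le_rfl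

variable [Fintype X]

lemma totalT_histT_nonneg (a b : Fin N) : 0 ≤ totalT (histT μ p) a b := by
  rw [totalT, Matrix.sum_apply]
  exact Finset.sum_nonneg fun x _ => histT_nonneg x a b

lemma totalT_histT_pos_iff {a b : Fin N} : 0 < totalT (histT μ p) a b ↔
    ∃ x, 0 < predProb μ (p a) [x] ∧ classOf μ (extendPast (p a) x) = classOf μ (p b) := by
  rw [totalT, Matrix.sum_apply, Finset.sum_pos_iff_of_nonneg fun x _ => histT_nonneg x a b]
  simp only [Finset.mem_univ, true_and]
  refine exists_congr fun x => ?_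
  unfold histT
  split_ifs with h
  · exact iff_of_true h.1 h
  · exact iff_of_false (lt_irrefl _) h

variable [MeasurableSingletonClass X] [IsProbabilityMeasure μ]

lemma FinitelyCharacterized.ae_mem_classOf (hfc : FinitelyCharacterized μ p) :
    ∀ᵐ q ∂pastMeasure μ, ∃ i, q ∈ classOf μ (p i) := by
  have hdisj : Pairwise (Function.onFun Disjoint fun i => classOf μ (p i)) := fun i j hij =>
    Set.disjoint_left.2 fun q hi hj => hfc.2.1 i j hij (classOf_eq_of_mem hi hj)
  have h : pastMeasure μ (⋃ i, classOf μ (p i)) = 1 := by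
    rw [measure_iUnion hdisj fun i => measurableSet_classOf _, tsum_fintype, hfc.2.2.2]
  have hmeas : MeasurableSet (⋃ i, classOf μ (p i)) := .iUnion fun i => measurableSet_classOf _
  filter_upwards [(mem_ae_iff_prob_eq_one hmeas).2 h] with q hq
  exact Set.mem_iUnion.1 hq

/-- By stationarity, no probability flows into a set of states that cannot be left. -/
lemma mem_of_totalT_pos_of_closed (hstat : Stationary μ) (hfc : FinitelyCharacterized μ p)
    {R : Set (Fin N)} (hR : ∀ a ∈ R, ∀ b, 0 < totalT (histT μ p) a b → b ∈ R)
    {a b : Fin N} (hab : 0 < totalT (histT μ p) a b) (hb : b ∈ R) : a ∈ R := by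
  by_contra ha
  have hcover := hfc.ae_mem_classOf
  have hreg : ∀ᵐ q ∂pastMeasure μ, Regular μ q := hcover.mono fun q ⟨_, hi⟩ => hi.1
  let B : Set (ℤ → X) := pastMap ⁻¹' ⋃ k ∈ R, classOf μ (p k)
  have hB : MeasurableSet B := measurable_pastMap <|
    .biUnion R.to_countable fun k _ => measurableSet_classOf _
  have hmp : MeasurePreserving shift μ μ := ⟨measurable_shift, hstat⟩
  have hcover_past : ∀ᵐ ω ∂μ, ∃ i, pastMap ω ∈ classOf μ (p i) :=
    ae_of_ae_map measurable_pastMap.aemeasurable hcover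
  have hcover_shift : ∀ᵐ ω ∂μ, ∃ i, pastMap (shift ω) ∈ classOf μ (p i) :=
    hmp.quasiMeasurePreserving.ae hcover_past
  have hpos : ∀ᵐ ω ∂μ, ∀ k, pastMap ω ∈ classOf μ (p k) → 0 < predProb μ (p k) [ω 0] := by
    have : ∀ᵐ ω ∂μ, ∀ (k : Fin N) (x : X), ¬ 0 < predProb μ (p k) [x] →
        ¬ (pastMap ω ∈ classOf μ (p k) ∧ ω 0 = x) := by
      simp only [ae_all_iff]
      intro k x hx
      have h := pastMeasureNext_classOf hstat hreg (p k) x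
      rw [ENNReal.ofReal_of_nonpos (not_lt.1 hx), zero_mul,
        pastMeasureNext_apply x (measurableSet_classOf _)] at h
      rw [ae_iff]
      simpa only [not_not] using h
    filter_upwards [this] with ω h k hk
    by_contra hx
    exact h k (ω 0) hx ⟨hk, rfl⟩
  have hsub : B ≤ᵐ[μ] shift ⁻¹' B := by
    filter_upwards [hcover_shift, hpos] with ω ⟨l, hl⟩ hω hωB
    obtain ⟨k, hk, hmem⟩ := Set.mem_iUnion₂.1 hωB
    refine Set.mem_iUnion₂.2 ⟨l, hR k hk l (totalT_histT_pos_iff.2 ⟨ω 0, hω k hmem, ?_⟩), hl⟩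
    refine classOf_eq_of_mem ?_ hl
    rw [pastMap_shift]
    exact extendPast_mem_classOf hstat (hfc.1 k) hmem (hω k hmem)
  have heq : B =ᵐ[μ] shift ⁻¹' B :=
    ae_eq_of_ae_subset_of_measure_ge hsub (hmp.measure_preimage hB.nullMeasurableSet).le
      hB.nullMeasurableSet (measure_ne_top _ _)
  obtain ⟨x, hx, hclass⟩ := totalT_histT_pos_iff.1 hab
  have hnull : μ {ω | pastMap ω ∈ classOf μ (p a) ∧ ω 0 = x} = 0 := by
    refine measure_mono_null ?_ (ae_le_set.1 heq.symm.le)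
    rintro ω ⟨hω, rfl⟩
    refine ⟨Set.mem_iUnion₂.2 ⟨b, hb, ?_⟩, fun hωB => ?_⟩
    · rw [pastMap_shift, ← hclass]
      exact extendPast_mem_classOf hstat (hfc.1 a) hω hx
    · obtain ⟨k, hk, hmem⟩ := Set.mem_iUnion₂.1 hωB
      have hka : k ≠ a := fun h => ha (h ▸ hk)
      exact hfc.2.1 k a hka (classOf_eq_of_mem hmem hω)
  rw [← pastMeasureNext_apply x (measurableSet_classOf _),
    pastMeasureNext_classOf hstat hreg] at hnull
  exact (ENNReal.mul_pos (ENNReal.ofReal_pos.2 hx).ne' (hfc.2.2.1 a).ne').ne' hnull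

end HistoryMachine

section Paths

variable {S : Type*} [Fintype S] [DecidableEq S] {A : Matrix S S ℝ}

lemma pow_apply_nonneg (hA : ∀ a b, 0 ≤ A a b) (n : ℕ) (a b : S) : 0 ≤ (A ^ n) a b := by
  induction n generalizing a b with
  | zero =>
    rw [pow_zero, Matrix.one_apply]
    split_ifs <;> simp
  | succ n ih =>
    rw [pow_succ, Matrix.mul_apply]
    exact Finset.sum_nonneg fun c _ => mul_nonneg (ih a c) (hA c b)

lemma pow_succ_apply_pos_iff (hA : ∀ a b, 0 ≤ A a b) (n : ℕ) (a b : S) :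
    0 < (A ^ (n + 1)) a b ↔ ∃ c, 0 < (A ^ n) a c ∧ 0 < A c b := by
  rw [pow_succ, Matrix.mul_apply, Finset.sum_pos_iff_of_nonneg
    fun c _ => mul_nonneg (pow_apply_nonneg hA n a c) (hA c b)]
  simp only [Finset.mem_univ, true_and]
  refine exists_congr fun c => ⟨fun h => ?_, fun h => mul_pos h.1 h.2⟩
  exact ⟨pos_of_mul_pos_left h (hA c b), pos_of_mul_pos_right h (pow_apply_nonneg hA n a c)⟩

lemma transGen_iff_exists_pow_pos (hA : ∀ a b, 0 ≤ A a b) {a b : S} :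
    Relation.TransGen (fun c d => 0 < A c d) a b ↔ ∃ n : ℕ, 1 ≤ n ∧ 0 < (A ^ n) a b := by
  constructor
  · intro h
    induction h with
    | single h => exact ⟨1, le_rfl, by simpa using h⟩
    | tail _ h ih =>
      obtain ⟨n, _, hn⟩ := ih
      exact ⟨n + 1, by omega, (pow_succ_apply_pos_iff hA n _ _).2 ⟨_, hn, h⟩⟩
  · rintro ⟨n, hn, h⟩
    induction n, hn using Nat.le_induction generalizing b with
    | base => exact .single (by simpa using h)
    | succ n _ ih =>
      obtain ⟨c, hc, hcb⟩ := (pow_succ_apply_pos_iff hA n a b).1 h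
      exact (ih hc).tail hcb

end Paths


/-- The directed graph of the history ε-machine consists entirely of disjoint
strongly connected components: whenever there is a path from i to j, there is one back. -/
theorem history_disjoint_scc
    {X : Type*} [Fintype X] [MeasurableSpace X] [MeasurableSingletonClass X]
    {N : ℕ} (μ : Measure (ℤ → X)) [IsProbabilityMeasure μ]
    (hstat : Stationary μ) (herg : Ergodic' μ)
    (p : Fin N → (ℕ → X)) (hfc : FinitelyCharacterized μ p) :
    ∀ (i j : Fin N) (n : ℕ), 1 ≤ n → 0 < (totalT (histT μ p) ^ n) i j →
      ∃ m : ℕ, 1 ≤ m ∧ 0 < (totalT (histT μ p) ^ m) j i := by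
  intro i j n hn hij
  have hpath := (transGen_iff_exists_pow_pos totalT_histT_nonneg).2 ⟨n, hn, hij⟩
  rw [← transGen_iff_exists_pow_pos totalT_histT_nonneg]
  let R : Set (Fin N) :=
    {k | Relation.ReflTransGen (fun c d => 0 < totalT (histT μ p) c d) j k}
  have hback : i ∈ R := by
    refine hpath.head_induction_on (motive := fun a _ => a ∈ R) (fun h => ?_) fun h _ ih => ?_
    · exact mem_of_totalT_pos_of_closed hstat hfc (fun a ha b hab => ha.tail hab) h .refl
    · exact mem_of_totalT_pos_of_closed hstat hfc (fun a ha b hab => ha.tail hab) h ih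
  obtain h | h := Relation.reflTransGen_iff_eq_or_transGen.1 hback
  · subst h
    exact hpath
  · exact h

end EM
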